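/- arXiv:math/0502072 — 2 statements merged into one kernel-verified Lean document; each statement's English description precedes it below -/
import Mathlib

section
/- Let ω₁, ω₂, ω₃, ω₄ ∈ ℝ⁴ be linearly independent over ℝ, and let f : ℝ⁴ → ℝ be a smooth function which is biharmonic on all of ℝ⁴ (Δ(Δf) = 0 everywhere) and 4-periodic, i.e. f(x + 2ω_j) = f(x) for every x ∈ ℝ⁴ and j = 1,2,3,4. Then f is constant. -/
/-- The `i`-th partial derivative of `f : ℝ⁴ → ℝ`. -/
noncomputable def pd (i : Fin 4) (f : EuclideanSpace ℝ (Fin 4) → ℝ) :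
    EuclideanSpace ℝ (Fin 4) → ℝ :=
  fun x => fderiv ℝ f x (EuclideanSpace.single i 1)

/-- The Laplacian of `f : ℝ⁴ → ℝ`: the sum of the second partial derivatives
along the four coordinate directions. -/
noncomputable def laplacian (f : EuclideanSpace ℝ (Fin 4) → ℝ) :
    EuclideanSpace ℝ (Fin 4) → ℝ :=
  fun x => ∑ i : Fin 4, pd i (pd i f) x

open MeasureTheory Submodule
open scoped Pointwise

section Periodic

variable {E ι : Type*} [NormedAddCommGroup E] [NormedSpace ℝ E] [Finite ι]

theorem exists_norm_le_of_lattice_periodic [ProperSpace E] (b : Module.Basis ι ℝ E) {h : E → ℝ}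
    (hc : Continuous h) (hp : ∀ l ∈ span ℤ (Set.range b), ∀ x, h (x + l) = h x) :
    ∃ C, ∀ x, ‖h x‖ ≤ C := by
  have hK := (ZSpan.fundamentalDomain_isBounded b).isCompact_closure
  obtain ⟨C, hC⟩ := hK.exists_bound_of_continuousOn hc.continuousOn
  have := Fintype.ofFinite ι
  refine ⟨C, fun x => ?_⟩
  have hx : h (ZSpan.fract b x) = h x := by
    have := hp _ (ZSpan.floor b x).2 (ZSpan.fract b x)
    rw [← this, ZSpan.fract_apply, sub_add_cancel]
  rw [← hx]
  exact hC _ (subset_closure (ZSpan.fract_mem_fundamentalDomain b x))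

theorem fderiv_lattice_periodic {L : Submodule ℤ E} {h : E → ℝ}
    (hp : ∀ l ∈ L, ∀ x, h (x + l) = h x) (l : E) (hl : l ∈ L) (x : E) :
    fderiv ℝ h (x + l) = fderiv ℝ h x := by
  rw [← fderiv_comp_add_right]
  congr 1
  exact funext (hp l hl)

variable [FiniteDimensional ℝ E] [MeasurableSpace E] [BorelSpace E]
  (μ : Measure E) [μ.IsAddHaarMeasure]

theorem setIntegral_fundamentalDomain_add (b : Module.Basis ι ℝ E) {h : E → ℝ}
    (hp : ∀ l ∈ span ℤ (Set.range b), ∀ x, h (x + l) = h x) (a : E) :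
    ∫ x in ZSpan.fundamentalDomain b, h (x + a) ∂μ = ∫ x in ZSpan.fundamentalDomain b, h x ∂μ := by
  have hD := ZSpan.isAddFundamentalDomain' b μ
  have hp' : ∀ (g : (span ℤ (Set.range b)).toAddSubgroup) (x : E), h (g +ᵥ x) = h x := fun g x => by
    rw [AddSubgroup.vadd_def, vadd_eq_add, add_comm, hp _ g.2]
  have key := (measurePreserving_add_right μ a).setIntegral_preimage_emb
    (measurableEmbedding_addRight a) h (a +ᵥ ZSpan.fundamentalDomain b)
  have hpre : (fun x => x + a) ⁻¹' (a +ᵥ ZSpan.fundamentalDomain b) = ZSpan.fundamentalDomain b := by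
    ext x
    simp [Set.mem_vadd_set_iff_neg_vadd_mem]
  rw [hpre] at key
  rw [key]
  have : Countable (span ℤ (Set.range b)).toAddSubgroup :=
    inferInstanceAs (Countable (span ℤ (Set.range b)))
  exact (hD.vadd_of_comm a).setIntegral_eq hD hp'

theorem integrableOn_fundamentalDomain (b : Module.Basis ι ℝ E) {h : E → ℝ} (hc : Continuous h) :
    IntegrableOn h (ZSpan.fundamentalDomain b) μ :=
  have : ProperSpace E := FiniteDimensional.proper_real E
  (hc.continuousOn.integrableOn_compact
    (ZSpan.fundamentalDomain_isBounded b).isCompact_closure).mono_set subset_closure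

/-- The directional derivative of a periodic function has mean zero. -/
theorem setIntegral_fundamentalDomain_fderiv (b : Module.Basis ι ℝ E) {h : E → ℝ}
    (hh : ContDiff ℝ 1 h) (hp : ∀ l ∈ span ℤ (Set.range b), ∀ x, h (x + l) = h x) (v : E) :
    ∫ x in ZSpan.fundamentalDomain b, fderiv ℝ h x v ∂μ = 0 := by
  have : ProperSpace E := FiniteDimensional.proper_real E
  have hc : Continuous fun x => fderiv ℝ h x v :=
    (hh.continuous_fderiv one_ne_zero).clm_apply continuous_const
  obtain ⟨C, hC⟩ := exists_norm_le_of_lattice_periodic b hc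
    fun l hl x => by rw [fderiv_lattice_periodic hp l hl]
  have hder := (hasDerivAt_integral_of_dominated_loc_of_deriv_le
    (μ := μ.restrict (ZSpan.fundamentalDomain b)) (x₀ := (0 : ℝ)) (s := Set.univ)
    (F := fun t x => h (x + t • v)) (F' := fun t x => fderiv ℝ h (x + t • v) v)
    (bound := fun _ => C) Filter.univ_mem
    (Filter.Eventually.of_forall fun t =>
      (hh.continuous.comp (by fun_prop : Continuous fun x : E => x + t • v)).aestronglyMeasurable)
    (integrableOn_fundamentalDomain μ b
      (hh.continuous.comp (by fun_prop : Continuous fun x : E => x + (0 : ℝ) • v)))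
    (hc.comp (by fun_prop : Continuous fun x : E => x + (0 : ℝ) • v)).aestronglyMeasurable
    (Filter.Eventually.of_forall fun x t _ => hC _)
    (integrableOn_fundamentalDomain μ b continuous_const)
    (Filter.Eventually.of_forall fun x t _ => by
      have h1 : HasDerivAt (fun t : ℝ => x + t • v) v t := by
        simpa using ((hasDerivAt_id t).smul_const v).const_add x
      exact ((hh.differentiable one_ne_zero) _).hasFDerivAt.comp_hasDerivAt t h1)).2
  simp_rw [setIntegral_fundamentalDomain_add μ b hp] at hder
  simpa using hder.unique (hasDerivAt_const _ _)

theorem eq_zero_of_setIntegral_fundamentalDomain_eq_zero (b : Module.Basis ι ℝ E) {h : E → ℝ}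
    (hc : Continuous h) (hp : ∀ l ∈ span ℤ (Set.range b), ∀ x, h (x + l) = h x)
    (h0 : ∀ x, 0 ≤ h x) (hi : ∫ x in ZSpan.fundamentalDomain b, h x ∂μ = 0) : h = 0 := by
  have hae := (setIntegral_eq_zero_iff_of_nonneg_ae (Filter.Eventually.of_forall h0)
    (integrableOn_fundamentalDomain μ b hc)).1 hi
  have : Countable (span ℤ (Set.range b)).toAddSubgroup :=
    inferInstanceAs (Countable (span ℤ (Set.range b)))
  have hz : μ {x | h x ≠ 0} = 0 := by
    refine (ZSpan.isAddFundamentalDomain' b μ).measure_zero_of_invariant _ (fun g => ?_) ?_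
    · ext x
      rw [Set.mem_vadd_set_iff_neg_vadd_mem]
      change h (-(g : E) + x) ≠ 0 ↔ h x ≠ 0
      rw [add_comm, hp _ (neg_mem g.2)]
    · have := ae_iff.1 hae
      rwa [Measure.restrict_apply' (ZSpan.fundamentalDomain_measurableSet b)] at this
  exact (Continuous.ae_eq_iff_eq μ hc continuous_const).1 (ae_iff.2 hz)

end Periodic

section Laplacian

theorem ContDiff.pd {f : EuclideanSpace ℝ (Fin 4) → ℝ} (hf : ContDiff ℝ (⊤ : ℕ∞) f) (i : Fin 4) :
    ContDiff ℝ (⊤ : ℕ∞) (pd i f) :=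
  (hf.fderiv_right (by simp)).clm_apply contDiff_const

theorem ContDiff.laplacian {f : EuclideanSpace ℝ (Fin 4) → ℝ} (hf : ContDiff ℝ (⊤ : ℕ∞) f) :
    ContDiff ℝ (⊤ : ℕ∞) (laplacian f) :=
  ContDiff.sum fun i _ => (hf.pd i).pd i

theorem pd_lattice_periodic {L : Submodule ℤ (EuclideanSpace ℝ (Fin 4))}
    {f : EuclideanSpace ℝ (Fin 4) → ℝ}
    (hp : ∀ l ∈ L, ∀ x, f (x + l) = f x) (i : Fin 4) : ∀ l ∈ L, ∀ x, pd i f (x + l) = pd i f x :=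
  fun l hl x => by simp only [pd, fderiv_lattice_periodic hp l hl]

theorem laplacian_lattice_periodic {L : Submodule ℤ (EuclideanSpace ℝ (Fin 4))}
    {f : EuclideanSpace ℝ (Fin 4) → ℝ}
    (hp : ∀ l ∈ L, ∀ x, f (x + l) = f x) :
    ∀ l ∈ L, ∀ x, laplacian f (x + l) = laplacian f x := fun l hl x =>
  Finset.sum_congr rfl fun i _ => pd_lattice_periodic (pd_lattice_periodic hp i) i l hl x

theorem pd_const_mul
    {f : EuclideanSpace ℝ (Fin 4) → ℝ} (hf : Differentiable ℝ f) (c : ℝ) (i : Fin 4) :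
    pd i (fun x => c * f x) = fun x => c * pd i f x := by
  funext x
  simp [pd, fderiv_const_mul (hf x)]

theorem pd_mul
    {f g : EuclideanSpace ℝ (Fin 4) → ℝ} (hf : Differentiable ℝ f) (hg : Differentiable ℝ g) (i : Fin 4) :
    pd i (fun x => f x * g x) = fun x => f x * pd i g x + g x * pd i f x := by
  funext x
  simp [pd, fderiv_fun_mul (hf x) (hg x)]

theorem pd_add
    {f g : EuclideanSpace ℝ (Fin 4) → ℝ} (hf : Differentiable ℝ f) (hg : Differentiable ℝ g) (i : Fin 4) :
    pd i (fun x => f x + g x) = fun x => pd i f x + pd i g x := by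
  funext x
  simp [pd, fderiv_fun_add (hf x) (hg x)]

theorem laplacian_const_mul
    {f : EuclideanSpace ℝ (Fin 4) → ℝ} (hf : ContDiff ℝ (⊤ : ℕ∞) f) (c : ℝ) (x : EuclideanSpace ℝ (Fin 4)) :
    laplacian (fun x => c * f x) x = c * laplacian f x := by
  simp only [laplacian, Finset.mul_sum]
  refine Finset.sum_congr rfl fun i _ => ?_
  rw [pd_const_mul (hf.differentiable (by simp)), pd_const_mul ((hf.pd i).differentiable (by simp))]

theorem laplacian_mul_self
    {f : EuclideanSpace ℝ (Fin 4) → ℝ} (hf : ContDiff ℝ (⊤ : ℕ∞) f) (x : EuclideanSpace ℝ (Fin 4)) :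
    laplacian (fun x => f x * f x) x = 2 * (f x * laplacian f x + ∑ i, pd i f x ^ 2) := by
  have hd := hf.differentiable (by simp)
  simp only [laplacian, Finset.mul_sum, ← Finset.sum_add_distrib]
  refine Finset.sum_congr rfl fun i _ => ?_
  have hdi := (hf.pd i).differentiable (by simp)
  rw [pd_mul hd hd, pd_add (hd.fun_mul hdi) (hd.fun_mul hdi), pd_mul hd hdi]
  ring

/-- A periodic subharmonic function is harmonic. -/
theorem laplacian_eq_zero_of_nonneg_of_periodic (b : Module.Basis (Fin 4) ℝ (EuclideanSpace ℝ (Fin 4)))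
    {f : EuclideanSpace ℝ (Fin 4) → ℝ}
    (hf : ContDiff ℝ (⊤ : ℕ∞) f)
    (hp : ∀ l ∈ span ℤ (Set.range b), ∀ x, f (x + l) = f x)
    (h0 : ∀ x, 0 ≤ laplacian f x) : laplacian f = 0 := by
  refine eq_zero_of_setIntegral_fundamentalDomain_eq_zero volume b hf.laplacian.continuous
    (laplacian_lattice_periodic hp) h0 ?_
  simp only [laplacian]
  rw [integral_finsetSum _ fun i _ =>
    integrableOn_fundamentalDomain volume b ((hf.pd i).pd i).continuous]
  exact Finset.sum_eq_zero fun i _ => setIntegral_fundamentalDomain_fderiv volume b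
    ((hf.pd i).of_le (by exact_mod_cast le_top)) (pd_lattice_periodic hp i) _

/-- A periodic harmonic function is constant. -/
theorem eq_of_laplacian_eq_zero_of_periodic (b : Module.Basis (Fin 4) ℝ (EuclideanSpace ℝ (Fin 4)))
    {f : EuclideanSpace ℝ (Fin 4) → ℝ}
    (hf : ContDiff ℝ (⊤ : ℕ∞) f)
    (hp : ∀ l ∈ span ℤ (Set.range b), ∀ x, f (x + l) = f x)
    (h0 : ∀ x, laplacian f x = 0) (x y : EuclideanSpace ℝ (Fin 4)) : f x = f y := by
  have hsq (x : EuclideanSpace ℝ (Fin 4)) : laplacian (fun x => f x * f x) x = 2 * ∑ i, pd i f x ^ 2 := by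
    rw [laplacian_mul_self hf, h0, mul_zero, zero_add]
  have hlap := laplacian_eq_zero_of_nonneg_of_periodic b (hf.mul hf)
    (fun l hl x => by simp only [hp l hl x]) fun x => by rw [hsq]; positivity
  refine is_const_of_fderiv_eq_zero (𝕜 := ℝ) (hf.differentiable (by simp)) (fun z => ?_) x y
  have hz : ∑ i, pd i f z ^ 2 = 0 := by
    have := congrFun hlap z
    rw [hsq, Pi.zero_apply] at this
    linarith
  have hpd (i : Fin 4) : pd i f z = 0 :=
    pow_eq_zero_iff two_ne_zero |>.1
      ((Finset.sum_eq_zero_iff_of_nonneg fun i _ => sq_nonneg _).1 hz i (Finset.mem_univ i))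
  refine ContinuousLinearMap.coe_injective
    ((EuclideanSpace.basisFun (Fin 4) ℝ).toBasis.ext fun i => ?_)
  simpa [pd] using hpd i

end Laplacian

/-- A smooth biharmonic function on ℝ⁴ which is `4`-periodic with respect to four
linearly independent half-periods `ω₁, ω₂, ω₃, ω₄` is constant. -/
theorem elliptic_biharmonic_const (ω : Fin 4 → EuclideanSpace ℝ (Fin 4))
    (hω : LinearIndependent ℝ ω)
    (f : EuclideanSpace ℝ (Fin 4) → ℝ)
    (hf : ContDiff ℝ (⊤ : ℕ∞) f)
    (hbih : ∀ x, laplacian (laplacian f) x = 0)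
    (hper : ∀ (x : EuclideanSpace ℝ (Fin 4)) (j : Fin 4), f (x + 2 • ω j) = f x) :
    ∀ x y, f x = f y := by
  have hω' : LinearIndependent ℝ fun j => (2 : ℝ) • ω j :=
    hω.units_smul fun _ => Units.mk0 2 two_ne_zero
  let b : Module.Basis (Fin 4) ℝ (EuclideanSpace ℝ (Fin 4)) :=
    basisOfLinearIndependentOfCardEqFinrank hω' (by simp)
  have hp : ∀ l ∈ span ℤ (Set.range b), ∀ x, f (x + l) = f x := by
    intro l hl
    induction hl using Submodule.span_induction with
    | mem l hl =>
      obtain ⟨j, rfl⟩ := hl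
      intro x
      simpa [b, two_smul] using hper x j
    | zero => simp
    | add l m _ _ hl hm => intro x; rw [← add_assoc, hm, hl]
    | smul n l _ hl => exact Function.Periodic.zsmul (f := f) hl n
  have hconst := eq_of_laplacian_eq_zero_of_periodic b hf.laplacian
    (laplacian_lattice_periodic hp) hbih
  have hlap := laplacian_eq_zero_of_nonneg_of_periodic b
    (f := fun x => laplacian f 0 * f x) (contDiff_const.mul hf)
    (fun l hl x => by simp only [hp l hl x])
    (fun x => by rw [laplacian_const_mul hf, hconst x 0]; exact mul_self_nonneg _)
  have hzero : laplacian f 0 = 0 := by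
    have := congrFun hlap 0
    rwa [laplacian_const_mul hf, Pi.zero_apply, mul_self_eq_zero] at this
  exact eq_of_laplacian_eq_zero_of_periodic b hf hp fun x => (hconst x 0).trans hzero
end

section
/- Fix N ∈ {1,2,3,4} and ℝ-linearly independent quaternions ω₁,…,ω_N, with w_k = 2(k₁ω₁ + ⋯ + k_Nω_N) for k ∈ ℤ^N. Let n ∈ ℕ be even with n ≥ N. Then for every x ∈ ℍ, the family k ↦ (w_k⁻¹ x)^n w_k⁻¹ indexed by k ∈ ℤ^N \ {0} is absolutely summable and its sum vanishes: Σ_{k ∈ ℤ^N \ {0}} (w_k⁻¹ x)^n w_k⁻¹ = 0. -/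
noncomputable section

/-- The lattice vector `w_k = 2(k₁ω₁ + ⋯ + k_Nω_N)` in the quaternions. -/
def wk {N : ℕ} (ω : Fin N → Quaternion ℝ) (k : Fin N → ℤ) : Quaternion ℝ :=
  2 * ∑ i : Fin N, (k i : ℝ) • ω i

theorem wk_neg {N : ℕ} (ω : Fin N → Quaternion ℝ) (k : Fin N → ℤ) :
    wk ω (-k) = -wk ω k := by
  simp [wk, Finset.sum_neg_distrib]

/-- The inverse powers of the sup norm on `ℤ^N` are summable for exponents above `N`. -/
theorem summable_norm_intCast_inv_pow {N m : ℕ} (hm : N < m) :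
    Summable fun k : Fin N → ℤ => ‖fun i => (k i : ℝ)‖⁻¹ ^ m := by
  let L := Submodule.span ℤ (Set.range (Pi.basisFun ℝ (Fin N)))
  have hL : Module.finrank ℤ L < m := by
    rw [ZLattice.rank ℝ L]
    simpa using hm
  have hmem : ∀ k : Fin N → ℤ, (fun i => (k i : ℝ)) ∈ L := fun k =>
    ((Pi.basisFun ℝ (Fin N)).mem_span_iff_repr_mem ℤ _).2 fun i => ⟨k i, by simp⟩
  refine (ZLattice.summable_norm_pow_inv L m hL).comp_injective
    (i := fun k : Fin N → ℤ => (⟨fun i => (k i : ℝ), hmem k⟩ : L)) fun k l h => ?_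
  ext i
  exact Int.cast_injective (congrFun (congrArg Subtype.val h) i)

theorem exists_norm_intCast_le_mul_norm_wk {N : ℕ} {ω : Fin N → Quaternion ℝ}
    (hω : LinearIndependent ℝ ω) :
    ∃ K : ℝ, 0 < K ∧ ∀ k : Fin N → ℤ, ‖fun i => (k i : ℝ)‖ ≤ K * ‖wk ω k‖ := by
  obtain ⟨K, hK, h⟩ := (Fintype.linearCombination ℝ ω).exists_antilipschitzWith
    (LinearMap.ker_eq_bot.2 hω.fintypeLinearCombination_injective)
  refine ⟨K, hK, fun k => ?_⟩
  have hk := h.le_mul_dist (fun i => (k i : ℝ)) 0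
  simp only [dist_zero_right, map_zero, Fintype.linearCombination_apply] at hk
  refine hk.trans (mul_le_mul_of_nonneg_left ?_ K.2)
  rw [wk, two_mul, ← two_smul ℝ, norm_smul, Real.norm_ofNat]
  linarith [norm_nonneg (∑ i, (k i : ℝ) • ω i)]

/-- For even `n ≥ N`, the lattice sum `Σ_{k ≠ 0} (w_k⁻¹ x)^n w_k⁻¹` is absolutely
summable and vanishes, by cancellation of opposite lattice points. -/
theorem even_lattice_sum_vanishes (N : ℕ) (hN1 : 1 ≤ N) (hN4 : N ≤ 4)
    (ω : Fin N → Quaternion ℝ) (hω : LinearIndependent ℝ ω)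
    (n : ℕ) (hn : Even n) (hnN : N ≤ n) (x : Quaternion ℝ) :
    Summable (fun k : {k : Fin N → ℤ // k ≠ 0} =>
      ‖((wk ω k.1)⁻¹ * x) ^ n * (wk ω k.1)⁻¹‖) ∧
    ∑' k : {k : Fin N → ℤ // k ≠ 0}, ((wk ω k.1)⁻¹ * x) ^ n * (wk ω k.1)⁻¹ = 0 := by
  constructor
  · obtain ⟨K, hK, hle⟩ := exists_norm_intCast_le_mul_norm_wk hω
    have hsum := ((summable_norm_intCast_inv_pow (Nat.lt_succ_of_le hnN)).subtype
      {k : Fin N → ℤ | k ≠ 0}).mul_left (‖x‖ ^ n * K ^ (n + 1))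
    refine hsum.of_nonneg_of_le (fun _ => norm_nonneg _) fun ⟨k, hk⟩ => ?_
    have hpos : 0 < ‖fun i => (k i : ℝ)‖ := by
      refine norm_pos_iff.2 fun h => hk ?_
      ext i
      exact Int.cast_eq_zero.1 (congrFun h i)
    have hinv : ‖wk ω k‖⁻¹ ≤ K * ‖fun i => (k i : ℝ)‖⁻¹ := by
      have hw : 0 < ‖wk ω k‖ := pos_of_mul_pos_right (hpos.trans_le (hle k)) hK.le
      rw [← div_eq_mul_inv, inv_eq_one_div, div_le_div_iff₀ hw hpos, one_mul]
      exact hle k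
    calc ‖((wk ω k)⁻¹ * x) ^ n * (wk ω k)⁻¹‖ = ‖x‖ ^ n * ‖wk ω k‖⁻¹ ^ (n + 1) := by
          simp only [norm_mul, norm_pow, norm_inv]
          ring
      _ ≤ ‖x‖ ^ n * (K * ‖fun i => (k i : ℝ)‖⁻¹) ^ (n + 1) := by gcongr
      _ = ‖x‖ ^ n * K ^ (n + 1) * ‖fun i => (k i : ℝ)‖⁻¹ ^ (n + 1) := by ring
  · let e : {k : Fin N → ℤ // k ≠ 0} ≃ {k : Fin N → ℤ // k ≠ 0} :=
      (Equiv.neg _).subtypeEquiv fun _ => neg_ne_zero.symm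
    have : IsAddTorsionFree (Quaternion ℝ) := .of_module_rat _
    refine self_eq_neg.1 ?_
    rw [← tsum_neg]
    refine (e.tsum_eq _).symm.trans (tsum_congr fun k => ?_)
    change ((wk ω (-k.1))⁻¹ * x) ^ n * (wk ω (-k.1))⁻¹ = _
    rw [wk_neg, inv_neg, neg_mul, hn.neg_pow, mul_neg]

end
end
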